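/- Suppose S is a free numerical semigroup that is reflective. Then S = ⟨A⟩ for a set A of one of the following forms: (1) A = {1}; (2) A = {2, 4n+3} for some n ∈ ℕ₀; (3) A = {3, 3n+2} for some n ∈ ℕ₀; or (4) A = {4, 4n+2, 4n+3} for some n ∈ ℕ₀. -/

import Mathlib

/-- A numerical semigroup: a subset of ℕ containing 0, closed under addition,
with finite complement. -/
def IsNumericalSemigroup (S : Set ℕ) : Prop :=
  0 ∈ S ∧ (∀ a ∈ S, ∀ b ∈ S, a + b ∈ S) ∧ Sᶜ.Finite

/-- The genus: number of gaps. -/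
noncomputable def genus (S : Set ℕ) : ℕ := Sᶜ.ncard

/-- The Frobenius number: the largest gap. -/
noncomputable def frob (S : Set ℕ) : ℕ := sSup Sᶜ

/-- The multiplicity: the smallest positive element. -/
noncomputable def mult (S : Set ℕ) : ℕ := sInf {n ∈ S | 0 < n}

/-- A numerical semigroup is reflective if for each z ∈ {0,...,g-1}
exactly one of z and z + g lies in S, where g is the genus. -/
def Reflective (S : Set ℕ) : Prop :=
  ∀ z < genus S, Xor' (z ∈ S) (z + genus S ∈ S)

/-- A set A is equidistributed modulo m if each residue class mod m contains
the same number of elements of A. -/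
def Equidistributed (A : Set ℕ) (m : ℕ) : Prop :=
  ∀ r₁ < m, ∀ r₂ < m, {x ∈ A | x % m = r₁}.ncard = {x ∈ A | x % m = r₂}.ncard

/-- The submonoid of ℕ generated by A. -/
def gen (A : Set ℕ) : Set ℕ := (AddSubmonoid.closure A : Set ℕ)

/-- The (unique) minimal generating set of a numerical semigroup: nonzero elements
not expressible as a sum of two nonzero elements. -/
def minGens (S : Set ℕ) : Set ℕ :=
  {n ∈ S | n ≠ 0 ∧ ∀ a ∈ S, ∀ b ∈ S, a ≠ 0 → b ≠ 0 → n ≠ a + b}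

/-- The embedding dimension: the cardinality of the minimal generating set. -/
noncomputable def embdim (S : Set ℕ) : ℕ := (minGens S).ncard

/-- The Apéry set of S relative to t: elements s of S with s - t ∉ S. -/
def aperySet (S : Set ℕ) (t : ℕ) : Set ℕ := {s ∈ S | ∀ u ∈ S, s ≠ u + t}

/-- Pseudo-Frobenius numbers: gaps h such that h + s ∈ S for every nonzero s ∈ S. -/
def pseudoFrobenius (S : Set ℕ) : Set ℕ :=
  {h | h ∉ S ∧ ∀ s ∈ S, s ≠ 0 → h + s ∈ S}

/-- Membership of an integer in (the image in ℤ of) a numerical semigroup. -/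
def memZ (S : Set ℕ) (z : ℤ) : Prop := 0 ≤ z ∧ z.toNat ∈ S

/-- Symmetric numerical semigroup. -/
def IsSymmetricNS (S : Set ℕ) : Prop :=
  ∀ z : ℤ, Xor' (memZ S z) (memZ S ((frob S : ℤ) - z))

/-- Pseudo-symmetric numerical semigroup. -/
def IsPseudoSymmetricNS (S : Set ℕ) : Prop :=
  2 ∣ frob S ∧ ∀ z : ℤ, z ≠ (frob S : ℤ) / 2 →
    Xor' (memZ S z) (memZ S ((frob S : ℤ) - z))

/-- Irreducible numerical semigroup. -/
def IsIrreducibleNS (S : Set ℕ) : Prop :=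
  ¬ ∃ T₁ T₂ : Set ℕ, IsNumericalSemigroup T₁ ∧ IsNumericalSemigroup T₂ ∧
    S ⊂ T₁ ∧ S ⊂ T₂ ∧ S = T₁ ∩ T₂

/-- A telescopic sequence a₁,...,a_k (1-indexed) of positive integers. -/
def TelescopicSeq (a : ℕ → ℕ) (k : ℕ) : Prop :=
  (∀ i ∈ Finset.Icc 1 k, 0 < a i) ∧
  ∀ j ∈ Finset.Icc 2 k,
    ((Finset.Icc 1 (j-1)).gcd a / (Finset.Icc 1 j).gcd a) * a j ∈
      gen (a '' Set.Icc 1 (j-1))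

/-- A free numerical semigroup: one generated by (the underlying set of)
a telescopic sequence. -/
def IsFreeNS (S : Set ℕ) : Prop :=
  ∃ (k : ℕ) (a : ℕ → ℕ), TelescopicSeq a k ∧ S = gen (a '' Set.Icc 1 k)

theorem add_mul_mem_gen {A : Set ℕ} {x m : ℕ} (hx : x ∈ gen A) (hm : m ∈ A) (t : ℕ) :
    x + t * m ∈ gen A :=
  (AddSubmonoid.closure A).add_mem hx
    (by simpa using (AddSubmonoid.closure A).nsmul_mem (AddSubmonoid.subset_closure hm) t)

theorem zero_mem_gen (A : Set ℕ) : 0 ∈ gen A := (AddSubmonoid.closure A).zero_mem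

theorem subset_gen (A : Set ℕ) : A ⊆ gen A := AddSubmonoid.subset_closure

theorem gen_subset_gen {A B : Set ℕ} (h : A ⊆ gen B) : gen A ⊆ gen B :=
  (AddSubmonoid.closure_le (S := AddSubmonoid.closure B)).2 h

theorem gen_subset {A S : Set ℕ} (hS : IsNumericalSemigroup S) (h : A ⊆ S) : gen A ⊆ S :=
  (AddSubmonoid.closure_le
    (S := { carrier := S, zero_mem' := hS.1, add_mem' := fun ha hb => hS.2.1 _ ha _ hb })).2 h

theorem dvd_of_mem_gen {A : Set ℕ} {d n : ℕ} (h : ∀ a ∈ A, d ∣ a) (hn : n ∈ gen A) : d ∣ n := by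
  induction hn using AddSubmonoid.closure_induction with
  | mem x hx => exact h x hx
  | zero => exact dvd_zero d
  | add x y _ _ hx hy => exact dvd_add hx hy

theorem IsNumericalSemigroup.eq_one_of_forall_dvd {S : Set ℕ} (hS : IsNumericalSemigroup S)
    {d : ℕ} (h : ∀ s ∈ S, d ∣ s) : d = 1 := by
  obtain ⟨N, hN⟩ := hS.2.2.bddAbove
  have hmem : ∀ n, N < n → n ∈ S := fun n hn => by
    by_contra hc
    exact absurd (hN hc) (by omega)
  have h₁ := h _ (hmem (N + 1) (by omega))
  have h₂ := h _ (hmem (N + 1 + 1) (by omega))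
  exact Nat.dvd_one.1 ((Nat.dvd_add_right h₁).1 h₂)

theorem IsNumericalSemigroup.mul_mem {S : Set ℕ} (hS : IsNumericalSemigroup S)
    {m : ℕ} (hm : m ∈ S) (t : ℕ) : t * m ∈ S := by
  induction t with
  | zero => simpa using hS.1
  | succ t ih => rw [Nat.succ_mul]; exact hS.2.1 _ ih _ hm

/-- In a free numerical semigroup other than `ℕ`, all generators except one have a common
divisor `d ≥ 2`. -/
theorem IsFreeNS.exists_dvd_or_eq_add {S : Set ℕ} (hS : IsNumericalSemigroup S)
    (hfree : IsFreeNS S) (h1 : 1 ∉ S) :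
    ∃ d a : ℕ, 2 ≤ d ∧ ¬ d ∣ a ∧ a ∈ S ∧ ∀ s ∈ S, d ∣ s ∨ ∃ s' ∈ S, s = a + s' := by
  classical
  obtain ⟨k, a, ⟨hpos, htel⟩, rfl⟩ := hfree
  have hk : (Finset.Icc 1 k).gcd a = 1 := by
    refine hS.eq_one_of_forall_dvd fun s hs => dvd_of_mem_gen ?_ hs
    rintro _ ⟨i, hi, rfl⟩
    exact Finset.gcd_dvd (by simpa using hi)
  have hex : ∃ j, (Finset.Icc 1 j).gcd a = 1 := ⟨k, hk⟩
  obtain ⟨j, hj, hjmin⟩ : ∃ j, (Finset.Icc 1 j).gcd a = 1 ∧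
      ∀ i < j, (Finset.Icc 1 i).gcd a ≠ 1 :=
    ⟨Nat.find hex, Nat.find_spec hex, fun i hi => Nat.find_min hex hi⟩
  have hjk : j ≤ k := by
    by_contra hc
    exact hjmin k (by omega) hk
  have hj0 : j ≠ 0 := by
    rintro rfl
    simp at hj
  have hmem : ∀ i, 1 ≤ i → i ≤ k → a i ∈ gen (a '' Set.Icc 1 k) := fun i h h' =>
    subset_gen _ ⟨i, ⟨h, h'⟩, rfl⟩
  have hj1 : j ≠ 1 := by
    rintro rfl
    have : a 1 = 1 := by simpa using hj
    have h := hmem 1 le_rfl hjk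
    rw [this] at h
    exact h1 h
  have hgcd : ∀ i, j ≤ i → (Finset.Icc 1 i).gcd a = 1 := fun i hi =>
    Nat.dvd_one.1 ((Finset.gcd_mono (Finset.Icc_subset_Icc le_rfl hi)).trans hj.dvd)
  have hred : ∀ i, 1 ≤ i → i ≤ k → a i ∈ gen (a '' Set.Icc 1 j) := by
    intro i
    induction i using Nat.strong_induction_on with
    | _ i ih =>
      intro h h'
      by_cases hij : i ≤ j
      · exact subset_gen _ ⟨i, ⟨h, hij⟩, rfl⟩
      · have := htel i (Finset.mem_Icc.2 ⟨by omega, h'⟩)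
        rw [hgcd i (by omega), hgcd (i - 1) (by omega), Nat.div_one, one_mul] at this
        refine gen_subset_gen ?_ this
        rintro _ ⟨l, ⟨hl, hl'⟩, rfl⟩
        exact ih l (by omega) hl (by omega)
  have hdvd : ∀ i, 1 ≤ i → i < j → (Finset.Icc 1 (j - 1)).gcd a ∣ a i := fun i h h' =>
    Finset.gcd_dvd (Finset.mem_Icc.2 ⟨h, by omega⟩)
  refine ⟨(Finset.Icc 1 (j - 1)).gcd a, a j, ?_, ?_, hmem j (by omega) hjk, ?_⟩
  · have hne := hjmin (j - 1) (by omega)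
    have hp := hpos 1 (Finset.mem_Icc.2 ⟨le_rfl, by omega⟩)
    have := Nat.pos_of_dvd_of_pos (hdvd 1 le_rfl (by omega)) hp
    omega
  · intro hd
    refine hjmin (j - 1) (by omega) (Nat.dvd_one.1 ((Finset.dvd_gcd fun i hi => ?_).trans hj.dvd))
    rw [Finset.mem_Icc] at hi
    rcases hi.2.lt_or_eq with h | rfl
    · exact hdvd i hi.1 h
    · exact hd
  · intro s hs
    have hs' : s ∈ gen (a '' Set.Icc 1 j) := by
      refine gen_subset_gen ?_ hs
      rintro _ ⟨i, hi, rfl⟩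
      exact hred i hi.1 hi.2
    have hsub : gen (a '' Set.Icc 1 j) ⊆ gen (a '' Set.Icc 1 k) :=
      gen_subset hS (by rintro _ ⟨i, hi, rfl⟩; exact hmem i hi.1 (hi.2.trans hjk))
    clear hs
    induction hs' using AddSubmonoid.closure_induction with
    | mem x hx =>
      obtain ⟨i, hi, rfl⟩ := hx
      rcases hi.2.lt_or_eq with h | rfl
      · exact Or.inl (hdvd i hi.1 h)
      · exact Or.inr ⟨0, hS.1, rfl⟩
    | zero => exact Or.inl (dvd_zero _)
    | add x y hx hy ihx ihy =>
      rcases ihx with hx' | ⟨s, hs, rfl⟩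
      · rcases ihy with hy' | ⟨s, hs, rfl⟩
        · exact Or.inl (dvd_add hx' hy')
        · exact Or.inr ⟨x + s, hS.2.1 _ (hsub hx) _ hs, by omega⟩
      · exact Or.inr ⟨s + y, hS.2.1 _ hs _ (hsub hy), by omega⟩

theorem Reflective.mem_iff {S : Set ℕ} (h : Reflective S) {z : ℕ} (hz : z < genus S) :
    z ∈ S ↔ z + genus S ∉ S := by
  rcases h z hz with ⟨h₁, h₂⟩ | ⟨h₁, h₂⟩ <;> tauto

/-- Every gap of a reflective numerical semigroup is less than twice the genus. -/
theorem Reflective.mem_of_two_mul_genus_le {S : Set ℕ} (hS : IsNumericalSemigroup S)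
    (h : Reflective S) {n : ℕ} (hn : 2 * genus S ≤ n) : n ∈ S := by
  classical
  by_contra hc
  set f : ℕ → ℕ := fun z => if z ∈ S then z + genus S else z
  have hf : Set.InjOn f (Finset.range (genus S)) := by
    intro x hx y hy hxy
    simp only [Finset.coe_range, Set.mem_Iio] at hx hy
    simp only [f] at hxy
    split_ifs at hxy <;> omega
  have hsub : insert n ((Finset.range (genus S)).image f) ⊆ hS.2.2.toFinset := by
    intro x hx
    rw [Set.Finite.mem_toFinset]
    rcases Finset.mem_insert.1 hx with rfl | hx
    · exact hc
    · obtain ⟨z, hz, rfl⟩ := Finset.mem_image.1 hx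
      have := h.mem_iff (Finset.mem_range.1 hz)
      simp only [f, Set.mem_compl_iff]
      split_ifs with hzS
      · exact this.1 hzS
      · exact hzS
  have hnot : n ∉ (Finset.range (genus S)).image f := by
    intro hx
    obtain ⟨z, hz, hzn⟩ := Finset.mem_image.1 hx
    rw [Finset.mem_range] at hz
    simp only [f] at hzn
    split_ifs at hzn <;> omega
  have hcard := Finset.card_le_card hsub
  rw [Finset.card_insert_of_notMem hnot, Finset.card_image_of_injOn hf, Finset.card_range,
    ← Set.ncard_eq_toFinset_card _ hS.2.2] at hcard
  exact absurd hcard (by simp [genus])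

/-- Below the genus, a reflective numerical semigroup consists of the multiples of its
multiplicity. -/
theorem Reflective.mem_iff_dvd {S : Set ℕ} (hS : IsNumericalSemigroup S) (h : Reflective S)
    {m : ℕ} (hmS : m ∈ S) (hm0 : 0 < m) (hmin : ∀ i ∈ S, 0 < i → m ≤ i)
    {z : ℕ} (hz : z < genus S) : z ∈ S ↔ m ∣ z := by
  constructor
  · intro hzS
    by_contra hd
    have hpos : 0 < z % m := Nat.pos_of_ne_zero fun h0 => hd (Nat.dvd_of_mod_eq_zero h0)
    have hlt := Nat.mod_lt z hm0
    have hgap : z % m ∉ S := fun hc => absurd (hmin _ hc hpos) (by omega)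
    have hmem : z % m + genus S ∈ S := by
      by_contra hc
      exact hgap ((h.mem_iff (lt_of_le_of_lt (Nat.mod_le z m) hz)).2 hc)
    refine (h.mem_iff hz).1 hzS ?_
    have := hS.2.1 _ hmem _ (hS.mul_mem hmS (z / m))
    have he := Nat.mod_add_div z m
    rw [mul_comm] at he
    rwa [show z + genus S = z % m + genus S + z / m * m by omega]
  · rintro ⟨t, rfl⟩
    rw [mul_comm]
    exact hS.mul_mem hmS t

theorem not_dvd_add_one {d x : ℕ} (hd : 2 ≤ d) (hx : d ∣ x) : ¬ d ∣ x + 1 := fun hy => by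
  have := Nat.le_of_dvd one_pos ((Nat.dvd_add_right hx).1 hy)
  omega

/-- Among `g + 1, ..., g + (m - 1)` with the multiple of `m` and one further element `a`
removed, there are two consecutive numbers as soon as `7 ≤ m`. -/
theorem lt_seven_of_dvd_add {m g d a : ℕ} (hd : 2 ≤ d)
    (h : ∀ i, 1 ≤ i → i < m → ¬ m ∣ g + i → d ∣ g + i ∨ g + i = a) : m < 7 := by
  by_contra! h7
  have huniq : ∀ i l, i < l → l < i + m → m ∣ g + i → m ∣ g + l → False := by
    intro i l hil hlm hx hy
    have := Nat.le_of_dvd (by omega) (Nat.dvd_sub hy hx)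
    omega
  have hadj : ∀ i, 1 ≤ i → i + 1 < m → (m ∣ g + i ∨ m ∣ g + (i + 1)) ∨
      (g + i = a ∨ g + (i + 1) = a) := by
    intro i hi him
    by_contra! hc
    obtain ⟨⟨hc₁, hc₂⟩, hc₃, hc₄⟩ := hc
    exact not_dvd_add_one hd ((h i hi (by omega) hc₁).resolve_right hc₃)
      ((h (i + 1) (by omega) him hc₂).resolve_right hc₄)
  have u : ∀ i l, i + 2 ≤ l → l ≤ i + 4 → (m ∣ g + i ∨ m ∣ g + (i + 1)) →
      (m ∣ g + l ∨ m ∣ g + (l + 1)) → False := by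
    rintro i l hil hl (hi | hi) (hl' | hl') <;>
      exact huniq _ _ (by omega) (by omega) hi hl'
  have v : ∀ i l, i + 2 ≤ l → (g + i = a ∨ g + (i + 1) = a) →
      (g + l = a ∨ g + (l + 1) = a) → False := by
    intro i l hil hi hl
    clear * - hil hi hl
    omega
  rcases hadj 1 (by omega) (by omega) with h₁ | h₁
  · rcases hadj 3 (by omega) (by omega) with h₃ | h₃
    · exact u 1 3 (by omega) (by omega) h₁ h₃
    · rcases hadj 5 (by omega) (by omega) with h₅ | h₅
      · exact u 1 5 (by omega) (by omega) h₁ h₅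
      · exact v 3 5 (by omega) h₃ h₅
  · rcases hadj 3 (by omega) (by omega) with h₃ | h₃
    · rcases hadj 5 (by omega) (by omega) with h₅ | h₅
      · exact u 3 5 (by omega) (by omega) h₃ h₅
      · exact v 1 5 (by omega) h₁ h₅
    · exact v 1 3 (by omega) h₁ h₃

/-- If all but one of the minimal generators of the reflective numerical semigroup of
multiplicity `m` and genus `g` have a common divisor which divides `m`, then `m ≤ 4`. -/
theorem mult_le_four_of_dvd_mult {m g d a : ℕ} (hm : 2 ≤ m) (hg : ¬ m ∣ g) (hd : 2 ≤ d)
    (h₁ : d ∣ m)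
    (h₂ : ∀ i, 1 ≤ i → i < m → ¬ m ∣ g + i → d ∣ g + i ∨ g + i = a)
    (h₃ : m ∣ g + 1 → d ∣ 2 * g + 1 ∨ 2 * g + 1 = a) :
    m = 2 ∧ g % 2 = 1 ∨ m = 3 ∧ g % 3 = 1 ∨ m = 4 ∧ g % 4 = 1 := by
  have hm7 := lt_seven_of_dvd_add hd h₂
  have hm' : m = 2 ∨ m = 3 ∨ m = 4 ∨ m = 5 ∨ m = 6 := by omega
  have e₁ := h₂ 1 le_rfl
  have e₂ := h₂ 2 (by omega)
  have e₃ := h₂ 3 (by omega)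
  have e₄ := h₂ 4 (by omega)
  clear h₂ hm hm7
  rcases hm' with rfl | rfl | rfl | rfl | rfl
  · omega
  · obtain rfl : d = 3 := ((Nat.dvd_prime Nat.prime_three).1 h₁).resolve_left (by omega)
    clear e₁ e₃ e₄
    omega
  · have hd2 : 2 ∣ d := by
      have := Nat.le_of_dvd (by omega) h₁
      interval_cases d <;> omega
    replace e₁ := fun x y => (e₁ x y).imp_left hd2.trans
    replace e₂ := fun x y => (e₂ x y).imp_left hd2.trans
    replace e₃ := fun x y => (e₃ x y).imp_left hd2.trans
    replace h₃ := fun x => (h₃ x).imp_left hd2.trans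
    clear e₄ hd2 h₁
    omega
  · obtain rfl : d = 5 := ((Nat.dvd_prime Nat.prime_five).1 h₁).resolve_left (by omega)
    have f₁ := fun h => (e₁ (by omega) h).resolve_left h
    have f₂ := fun h => (e₂ (by omega) h).resolve_left h
    have f₃ := fun h => (e₃ (by omega) h).resolve_left h
    clear h₃ e₁ e₂ e₃ e₄
    omega
  · have hd6 : 2 ∣ d ∨ d = 3 := by
      have := Nat.le_of_dvd (by omega) h₁
      clear * - hd h₁ this
      interval_cases d <;> omega
    rcases hd6 with hd2 | rfl
    · replace e₁ := fun x y => (e₁ x y).imp_left hd2.trans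
      replace e₂ := fun x y => (e₂ x y).imp_left hd2.trans
      replace e₃ := fun x y => (e₃ x y).imp_left hd2.trans
      replace e₄ := fun x y => (e₄ x y).imp_left hd2.trans
      clear h₃ hd2 h₁
      rcases Nat.mod_two_eq_zero_or_one g with h0 | h0
      · clear e₂ e₄
        omega
      · clear e₁ e₃
        omega
    · clear h₃ h₁ e₄
      omega

/-- If all the minimal generators of the reflective numerical semigroup of multiplicity `m`
and genus `g`, except for `m`, have a common divisor, then `m ≤ 4`. -/
theorem mult_le_four_of_not_dvd_mult {m g d : ℕ} (hm : 2 ≤ m) (hg : ¬ m ∣ g) (hd : 2 ≤ d)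
    (h₁ : ¬ d ∣ m)
    (h₂ : ∀ i, 1 ≤ i → i < m → ¬ m ∣ g + i → d ∣ g + i)
    (h₃ : m ∣ g + 1 → d ∣ 2 * g + 1) :
    m = 2 ∧ g % 2 = 1 ∨ m = 3 ∧ g % 3 = 1 ∨ m = 4 ∧ g % 4 = 1 := by
  have hm7 := lt_seven_of_dvd_add (a := 0) hd fun i hi him h => Or.inl (h₂ i hi him h)
  have hm' : m = 2 ∨ m = 3 ∨ m = 4 ∨ m = 5 ∨ m = 6 := by omega
  have hs : ∀ i, 1 ≤ i → i + 1 < m → ¬ m ∣ g + i → ¬ m ∣ g + (i + 1) → False :=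
    fun i hi him h h' => not_dvd_add_one hd (h₂ i hi (by omega) h) (h₂ _ (by omega) him h')
  rcases hm' with rfl | rfl | rfl | rfl | rfl
  · omega
  · by_contra hc
    refine h₁ ?_
    have := Nat.dvd_sub ((h₂ 2 (by omega) (by omega) (by omega)).mul_left 2) (h₃ (by omega))
    rwa [show 2 * (g + 2) - (2 * g + 1) = 3 by omega] at this
  · by_contra hc
    by_cases h : g % 4 = 2
    · refine h₁ ?_
      have := Nat.dvd_sub (h₂ 3 (by omega) (by omega) (by omega))
        (h₂ 1 (by omega) (by omega) (by omega))
      rw [show g + 3 - (g + 1) = 2 by omega] at this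
      exact this.mul_left 2
    · exact hs 2 (by omega) (by omega) (by omega) (by omega)
  · exfalso
    by_cases h : 5 ∣ g + 1 ∨ 5 ∣ g + 2
    · exact hs 3 (by omega) (by omega) (by omega) (by omega)
    · exact hs 1 (by omega) (by omega) (by omega) (by omega)
  · exfalso
    by_cases h : 6 ∣ g + 1 ∨ 6 ∣ g + 2
    · exact hs 3 (by omega) (by omega) (by omega) (by omega)
    · exact hs 1 (by omega) (by omega) (by omega) (by omega)

theorem stmt14 (S : Set ℕ) (hS : IsNumericalSemigroup S) (hfree : IsFreeNS S)
    (hrefl : Reflective S) :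
    ∃ A : Set ℕ, S = gen A ∧
      (A = {1} ∨ (∃ n : ℕ, A = {2, 4 * n + 3}) ∨ (∃ n : ℕ, A = {3, 3 * n + 2}) ∨
        (∃ n : ℕ, A = {4, 4 * n + 2, 4 * n + 3})) := by
  classical
  by_cases h1 : 1 ∈ S
  · refine ⟨{1}, Set.Subset.antisymm (fun n _ => ?_) (gen_subset hS (by simpa using h1)),
      Or.inl rfl⟩
    simpa using add_mul_mem_gen (zero_mem_gen {1}) (Set.mem_singleton 1) n
  obtain ⟨d, a, hd, hda, haS, hsplit⟩ := hfree.exists_dvd_or_eq_add hS h1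
  have hlarge : ∀ n, 2 * genus S ≤ n → n ∈ S := fun n => hrefl.mem_of_two_mul_genus_le hS
  have hrefl' : ∀ z < genus S, z ∈ S ↔ z + genus S ∉ S := fun z => hrefl.mem_iff
  have hex : ∃ n, n ∈ S ∧ 0 < n := ⟨2 * genus S + 1, hlarge _ (by omega), by omega⟩
  obtain ⟨m, ⟨hmS, hm0⟩, hmin'⟩ : ∃ m, (m ∈ S ∧ 0 < m) ∧ ∀ i < m, ¬ (i ∈ S ∧ 0 < i) :=
    ⟨Nat.find hex, Nat.find_spec hex, fun i hi => Nat.find_min hex hi⟩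
  have hmin : ∀ i ∈ S, 0 < i → m ≤ i := fun i hi hi0 => by
    by_contra hc
    exact hmin' i (by omega) ⟨hi, hi0⟩
  have hsmall : ∀ z < genus S, z ∈ S ↔ m ∣ z := fun z =>
    hrefl.mem_iff_dvd hS hmS hm0 hmin
  generalize genus S = g at hlarge hrefl' hsmall
  have hm1 : m ≠ 1 := fun h => h1 (h ▸ hmS)
  have hg0 : 0 < g := Nat.pos_of_ne_zero fun h => h1 (hlarge 1 (by omega))
  have hmid : ∀ z < g, z + g ∈ S ↔ ¬ m ∣ z := fun z hz => by
    rw [← hsmall z hz, hrefl' z hz, not_not]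
  have hgS : g ∉ S := by simpa using (hmid 0 hg0).not.2 (by simp)
  have hmg : ¬ m ∣ g := by
    rintro ⟨t, rfl⟩
    rw [mul_comm] at hgS
    exact hgS (hS.mul_mem hmS t)
  have hmle : m ≤ g + 1 := by
    rcases Nat.lt_or_ge 1 g with h | h
    · have := (hmid 1 h).2 (by simpa using hm1)
      have := hmin _ this (by omega)
      omega
    · have := hmin _ (hlarge 2 (by omega)) (by omega)
      omega
  have ha0 : 0 < a := Nat.pos_of_ne_zero fun h => hda (h ▸ dvd_zero d)
  have hma := hmin a haS ha0
  have hupS : ∀ i, 0 < i → i < m → g + i ∈ S := by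
    intro i hi him
    rcases Nat.lt_or_ge i g with h | h
    · rw [add_comm]
      exact (hmid i h).2 fun hc => absurd (Nat.le_of_dvd hi hc) (by omega)
    · exact hlarge _ (by omega)
  have key₁ : d ∣ m ∨ m = a := by
    refine (hsplit m hmS).imp_right ?_
    rintro ⟨s, -, h⟩
    omega
  have key₂ : ∀ i, 1 ≤ i → i < m → ¬ m ∣ g + i → d ∣ g + i ∨ g + i = a := by
    intro i hi him hdi
    refine (hsplit _ (hupS i hi him)).imp_right ?_
    rintro ⟨s, hs, h⟩
    rcases Nat.eq_zero_or_pos s with rfl | hs0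
    · exact h
    exfalso
    have hms := hmin s hs hs0
    rcases Nat.lt_or_ge a g with hag | hag <;> rcases Nat.lt_or_ge s g with hsg | hsg
    · exact hdi (h ▸ dvd_add ((hsmall a hag).1 haS) ((hsmall s hsg).1 hs))
    · omega
    · omega
    · exact hgS ((show s = g by omega) ▸ hs)
  have key₃ : m ∣ g + 1 → d ∣ 2 * g + 1 ∨ 2 * g + 1 = a := by
    intro hdvd
    refine (hsplit _ (hlarge _ (by omega))).imp_right ?_
    have main : ∀ x y, x ∈ S → y ∈ S → 0 < x → x < g → 2 * g + 1 = x + y → False := by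
      intro x y hx hy hx0 hxg h
      have hmx := hmin x hx hx0
      have hxd := (hsmall x hxg).1 hx
      rw [show y = (g + 1 - x) + g by omega] at hy
      exact (hmid _ (by omega)).1 hy (Nat.dvd_sub hdvd hxd)
    rintro ⟨s, hs, h⟩
    rcases Nat.eq_zero_or_pos s with rfl | hs0
    · exact h
    exfalso
    rcases Nat.lt_or_ge a g with hag | hag
    · exact main a s haS hs ha0 hag h
    rcases Nat.lt_or_ge s g with hsg | hsg
    · exact main s a hs haS hs0 hsg (by omega)
    rcases (show a = g ∨ s = g by omega) with rfl | rfl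
    · exact hgS haS
    · exact hgS hs
  have hcases : m = 2 ∧ g % 2 = 1 ∨ m = 3 ∧ g % 3 = 1 ∨ m = 4 ∧ g % 4 = 1 := by
    rcases key₁ with hdm | rfl
    · exact mult_le_four_of_dvd_mult (by omega) hmg hd hdm key₂ key₃
    · refine mult_le_four_of_not_dvd_mult (by omega) hmg hd hda
        (fun i hi him h => (key₂ i hi him h).resolve_right fun he => h (dvd_of_eq he.symm))
        (fun h => (key₃ h).resolve_right fun he => ?_)
      have := Nat.le_of_dvd (by omega) h
      omega
  have hlow : ∀ n ∈ S, ¬ m ∣ n → g < n := by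
    intro n hn hmn
    by_contra hc
    rcases Nat.lt_or_ge n g with h | h
    · exact hmn ((hsmall n h).1 hn)
    · exact hgS ((show n = g by omega) ▸ hn)
  have hhigh : ∀ n ∈ S, g ≤ n → m ∣ n - g → 2 * g ≤ n := by
    intro n hn hgn hmn
    by_contra hc
    rw [show n = n - g + g by omega] at hn
    exact (hmid _ (by omega)).1 hn hmn
  have hreach : ∀ {A : Set ℕ} {n : ℕ} (x : ℕ), m ∈ A → x ∈ gen A → x ≤ n → m ∣ n - x →
      n ∈ gen A := by
    rintro A n x hmA hx hxn ⟨t, ht⟩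
    have := add_mul_mem_gen hx hmA t
    rw [mul_comm] at ht
    rwa [← ht, Nat.add_sub_cancel' hxn] at this
  rcases hcases with ⟨rfl, hg⟩ | ⟨rfl, hg⟩ | ⟨rfl, hg⟩
  · refine ⟨{2, 4 * (g / 2) + 3}, Set.Subset.antisymm (fun n hn => ?_) (gen_subset hS ?_),
      Or.inr (Or.inl ⟨_, rfl⟩)⟩
    · by_cases h0 : 2 ∣ n
      · exact hreach 0 (by simp) (zero_mem_gen _) (by omega) (by omega)
      · have := hlow n hn h0
        have := hhigh n hn (by omega) (by omega)
        exact hreach (4 * (g / 2) + 3) (by simp) (subset_gen _ (by simp)) (by omega) (by omega)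
    · rintro x (rfl | rfl)
      · exact hmS
      · exact hlarge _ (by omega)
  · refine ⟨{3, 3 * (g / 3) + 2}, Set.Subset.antisymm (fun n hn => ?_) (gen_subset hS ?_),
      Or.inr (Or.inr (Or.inl ⟨_, rfl⟩))⟩
    · have hb : 3 * (g / 3) + 2 ∈ gen {3, 3 * (g / 3) + 2} := subset_gen _ (by simp)
      by_cases h0 : 3 ∣ n
      · exact hreach 0 (by simp) (zero_mem_gen _) (by omega) (by omega)
      · have := hlow n hn h0
        by_cases h2 : n % 3 = 2
        · exact hreach _ (by simp) hb (by omega) (by omega)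
        · have := hhigh n hn (by omega) (by omega)
          exact hreach _ (by simp) (AddSubmonoid.add_mem _ hb hb) (by omega) (by omega)
    · rintro x (rfl | rfl)
      · exact hmS
      · rw [show 3 * (g / 3) + 2 = g + 1 by omega]
        exact hupS 1 (by omega) (by omega)
  · refine ⟨{4, 4 * (g / 4) + 2, 4 * (g / 4) + 3},
      Set.Subset.antisymm (fun n hn => ?_) (gen_subset hS ?_),
      Or.inr (Or.inr (Or.inr ⟨_, rfl⟩))⟩
    · have hb : 4 * (g / 4) + 2 ∈ gen {4, 4 * (g / 4) + 2, 4 * (g / 4) + 3} :=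
        subset_gen _ (by simp)
      have hc : 4 * (g / 4) + 3 ∈ gen {4, 4 * (g / 4) + 2, 4 * (g / 4) + 3} :=
        subset_gen _ (by simp)
      by_cases h0 : 4 ∣ n
      · exact hreach 0 (by simp) (zero_mem_gen _) (by omega) (by omega)
      · have := hlow n hn h0
        by_cases h2 : n % 4 = 2
        · exact hreach _ (by simp) hb (by omega) (by omega)
        by_cases h3 : n % 4 = 3
        · exact hreach _ (by simp) hc (by omega) (by omega)
        · have := hhigh n hn (by omega) (by omega)
          exact hreach _ (by simp) (AddSubmonoid.add_mem _ hb hc) (by omega) (by omega)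
    · rintro x (rfl | rfl | rfl)
      · exact hmS
      · rw [show 4 * (g / 4) + 2 = g + 1 by omega]
        exact hupS 1 (by omega) (by omega)
      · rw [show 4 * (g / 4) + 3 = g + 2 by omega]
        exact hupS 2 (by omega) (by omega)
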